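/- (Multi-stage extension of the combination method.) Let (Ω, μ) be a probability space with a filtration F₀ ⊆ F₁ ⊆ ... ⊆ F_K, where F₀ is the trivial σ-algebra. Let P₁, ..., P_K : Ω → ℝ be random variables taking values in (0,1) such that for each k, P_k is F_k-measurable and for every u ∈ [0,1] the conditional expectation E[1{P_k ≤ u} | F_{k−1}] equals u μ-almost everywhere (each stage-k p-value is conditionally uniform given all prior-stage data). Let w₁, ..., w_K be positive real constants with w₁² + ... + w_K² = 1. Then the random variable S = Σ_{k=1}^{K} w_k·z(P_k) has the standard Gaussian distribution, and consequently the combined p-value Φ̄(S) is uniformly distributed on (0,1). -/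

import Mathlib

open MeasureTheory ProbabilityTheory Set

/-- The cumulative distribution function `Φ` of the standard Gaussian measure on `ℝ`. -/
noncomputable def stdGaussCDF (x : ℝ) : ℝ := ((gaussianReal 0 1) (Set.Iic x)).toReal

/-- The survival function `Φ̄ = 1 - Φ` of the standard Gaussian measure. -/
noncomputable def stdGaussSurv (x : ℝ) : ℝ := 1 - stdGaussCDF x

/-- `z(u) = Φ̄⁻¹(u)`, the inverse of the standard Gaussian survival function. -/
noncomputable def zval : ℝ → ℝ := Function.invFun stdGaussSurv

/-- The uniform distribution on `(0,1)`: Lebesgue measure restricted to `(0,1)`. -/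
noncomputable def unif01 : Measure ℝ := volume.restrict (Set.Ioo (0 : ℝ) 1)

lemma cdf_eq_aux (x : ℝ) : stdGaussCDF x = cdf (gaussianReal 0 1) x := by
  rw [cdf_eq_real]; rfl

lemma cdf_cont : Continuous stdGaussCDF := by
  have : stdGaussCDF = cdf (gaussianReal 0 1) := funext cdf_eq_aux
  rw [this, continuous_iff_continuousAt]
  intro x
  have : NullSingletonClass (gaussianReal 0 1) := nullSingletonClass_gaussianReal one_ne_zero
  rw [(cdf (gaussianReal 0 1)).mono.continuousAt_iff_leftLim_eq_rightLim,
    StieltjesFunction.rightLim_eq]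
  have h := (cdf (gaussianReal 0 1)).measure_singleton x
  rw [measure_cdf, measure_singleton] at h
  have h2 := ENNReal.ofReal_eq_zero.1 h.symm
  have h3 := (cdf (gaussianReal 0 1)).mono.leftLim_le (le_refl x)
  linarith

lemma cdf_strict : StrictMono stdGaussCDF := by
  intro a b hab
  have h0 : (gaussianReal 0 1) (Ioc a b) ≠ 0 := by
    intro h
    have := gaussianReal_absolutelyContinuous' 0 (one_ne_zero) h
    rw [Real.volume_Ioc, ENNReal.ofReal_eq_zero] at this
    linarith
  have h := (cdf (gaussianReal 0 1)).measure_Ioc a b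
  rw [measure_cdf] at h
  rw [h, ne_eq, ENNReal.ofReal_eq_zero] at h0
  rw [cdf_eq_aux, cdf_eq_aux]
  linarith

lemma surv_cont : Continuous stdGaussSurv := continuous_const.sub cdf_cont

lemma surv_anti : StrictAnti stdGaussSurv := fun a b h => by
  have := cdf_strict h
  unfold stdGaussSurv; linarith

lemma surv_mem (x : ℝ) : stdGaussSurv x ∈ Ioo (0:ℝ) 1 := by
  have h1 := surv_anti (show x < x + 1 by linarith)
  have h2 := surv_anti (show x - 1 < x by linarith)
  have h3 := cdf_le_one (gaussianReal 0 1) (x+1)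
  have h4 := cdf_nonneg (gaussianReal 0 1) (x-1)
  rw [← cdf_eq_aux] at h3 h4
  unfold stdGaussSurv at *
  constructor <;> linarith

lemma surv_surj {u : ℝ} (hu : u ∈ Ioo (0:ℝ) 1) : ∃ x, stdGaussSurv x = u := by
  have : (1 - u) ∈ range stdGaussCDF := by
    have hf : stdGaussCDF = cdf (gaussianReal 0 1) := funext cdf_eq_aux
    have hb := tendsto_cdf_atBot (gaussianReal 0 1)
    have ht := tendsto_cdf_atTop (gaussianReal 0 1)
    rw [← hf] at hb ht
    exact mem_range_of_exists_le_of_exists_ge cdf_cont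
      ((hb.eventually (ge_mem_nhds (show (0:ℝ) < 1 - u by linarith [hu.2]))).exists)
      ((ht.eventually (le_mem_nhds (show 1 - u < (1:ℝ) by linarith [hu.1]))).exists)
  obtain ⟨x, hx⟩ := this
  exact ⟨x, by unfold stdGaussSurv; linarith⟩

lemma surv_zval {u : ℝ} (hu : u ∈ Ioo (0:ℝ) 1) : stdGaussSurv (zval u) = u :=
  Function.invFun_eq (surv_surj hu)

lemma le_zval {u x : ℝ} (hu : u ∈ Ioo (0:ℝ) 1) : x ≤ zval u ↔ u ≤ stdGaussSurv x := by
  rw [← surv_anti.le_iff_ge, surv_zval hu]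

lemma gauss_Ici (x : ℝ) : (gaussianReal 0 1) (Ici x) = ENNReal.ofReal (stdGaussSurv x) := by
  have : NullSingletonClass (gaussianReal 0 1) := nullSingletonClass_gaussianReal one_ne_zero
  rw [← measure_congr (Ioi_ae_eq_Ici (μ := gaussianReal 0 1) (a := x)), ← compl_Iic,
    prob_compl_eq_one_sub measurableSet_Iic, ← ofReal_cdf, ← cdf_eq_aux, stdGaussSurv,
    ENNReal.ofReal_sub _ (by rw [cdf_eq_aux]; exact cdf_nonneg _ _), ENNReal.ofReal_one]

lemma gauss_map_surv : (gaussianReal 0 1).map stdGaussSurv = unif01 := by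
  have hm := surv_cont.measurable
  have : IsProbabilityMeasure ((gaussianReal 0 1).map stdGaussSurv) :=
    Measure.isProbabilityMeasure_map hm.aemeasurable
  refine Measure.ext_of_Iic _ _ fun u => ?_
  rw [Measure.map_apply hm measurableSet_Iic, unif01, Measure.restrict_apply measurableSet_Iic]
  rcases le_or_gt u 0 with h0 | h0
  · have e1 : stdGaussSurv ⁻¹' Iic u = ∅ := by
      ext x; have := (surv_mem x).1
      simp only [mem_preimage, mem_Iic, mem_empty_iff_false, iff_false]; linarith
    have e2 : Iic u ∩ Ioo (0:ℝ) 1 = ∅ := by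
      ext x
      simp only [mem_inter_iff, mem_Iic, mem_Ioo, mem_empty_iff_false, iff_false]
      rintro ⟨_, _, _⟩; linarith
    rw [e1, e2]; simp
  rcases lt_or_ge u 1 with h1 | h1
  · have e1 : stdGaussSurv ⁻¹' Iic u = Ici (zval u) := by
      ext x
      rw [mem_preimage, mem_Iic, mem_Ici, ← surv_anti.le_iff_ge (a := x), surv_zval ⟨h0, h1⟩]
    have e2 : Iic u ∩ Ioo (0:ℝ) 1 = Ioc 0 u := by
      ext x
      simp only [mem_inter_iff, mem_Iic, mem_Ioo, mem_Ioc]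
      constructor
      · rintro ⟨a, b, c⟩; exact ⟨b, a⟩
      · rintro ⟨a, b⟩; exact ⟨b, a, by linarith⟩
    rw [e1, e2, gauss_Ici, surv_zval ⟨h0, h1⟩, Real.volume_Ioc, sub_zero]
  · have e1 : stdGaussSurv ⁻¹' Iic u = univ := by
      ext x; have := (surv_mem x).2
      simp only [mem_preimage, mem_Iic, mem_univ, iff_true]; linarith
    have e2 : Iic u ∩ Ioo (0:ℝ) 1 = Ioo 0 1 := by
      rw [inter_eq_right]; intro x hx; exact hx.2.le.trans h1
    rw [e1, e2]; simp

lemma meas_aux {Ω : Type*} (m : MeasurableSpace Ω) (P : Ω → ℝ) (hP : Measurable[m] P)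
    (hv : ∀ ω, P ω ∈ Ioo (0:ℝ) 1) : Measurable[m] (fun ω => zval (P ω)) := by
  refine measurable_of_Ici fun x => ?_
  have : (fun ω => zval (P ω)) ⁻¹' Ici x = P ⁻¹' Iic (stdGaussSurv x) := by
    ext ω; exact le_zval (hv ω)
  rw [this]; exact hP measurableSet_Iic

lemma key_aux {Ω : Type*} (m : MeasurableSpace Ω) [m0 : MeasurableSpace Ω] (μ : Measure Ω) [IsProbabilityMeasure μ]
    (hm : m ≤ m0) (P : Ω → ℝ) (hP : Measurable P)
    (hv : ∀ ω, P ω ∈ Ioo (0:ℝ) 1)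
    (hc : ∀ u ∈ Set.Icc (0 : ℝ) 1,
      μ[Set.indicator {ω | P ω ≤ u} (fun _ => (1 : ℝ)) | m] =ᵐ[μ] fun _ => u)
    (A : Set Ω) (hA : MeasurableSet[m] A) (x : ℝ) :
    μ (A ∩ (fun ω => zval (P ω)) ⁻¹' Ici x) = μ A * ENNReal.ofReal (stdGaussSurv x) := by
  have e : (fun ω => zval (P ω)) ⁻¹' Ici x = {ω | P ω ≤ stdGaussSurv x} := by
    ext ω; exact le_zval (hv ω)
  rw [e]
  set u := stdGaussSurv x
  have hu : u ∈ Ioo (0:ℝ) 1 := surv_mem x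
  have hs : MeasurableSet {ω | P ω ≤ u} := hP measurableSet_Iic
  have h1 := setIntegral_condExp hm
    (f := Set.indicator {ω | P ω ≤ u} (fun _ => (1 : ℝ))) (μ := μ)
    ((integrable_const (1:ℝ)).indicator hs) hA
  rw [setIntegral_congr_ae (hm _ hA) ((hc u ⟨hu.1.le, hu.2.le⟩).mono fun ω h _ => h),
    setIntegral_indicator hs] at h1
  simp only [setIntegral_const, smul_eq_mul, mul_one] at h1
  rw [← ENNReal.ofReal_toReal (measure_ne_top μ (A ∩ _)),
    ← ENNReal.ofReal_toReal (measure_ne_top μ A), ← ENNReal.ofReal_mul ENNReal.toReal_nonneg]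
  exact congrArg _ h1.symm

lemma law_aux {Ω : Type*} [m0 : MeasurableSpace Ω] (μ : Measure Ω) [IsProbabilityMeasure μ]
    (Z : Ω → ℝ) (hZ : Measurable Z)
    (h : ∀ x, μ (Z ⁻¹' Ici x) = ENNReal.ofReal (stdGaussSurv x)) :
    μ.map Z = gaussianReal 0 1 := by
  have : IsProbabilityMeasure (μ.map Z) := Measure.isProbabilityMeasure_map hZ.aemeasurable
  refine Measure.ext_of_Ici _ _ fun x => ?_
  rw [Measure.map_apply hZ measurableSet_Ici, h, gauss_Ici]

lemma indep_aux {Ω : Type*} (m : MeasurableSpace Ω) [m0 : MeasurableSpace Ω] (μ : Measure Ω) [IsProbabilityMeasure μ]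
    (hm : m ≤ m0)
    (Z : Ω → ℝ) (hZ : Measurable Z) (S : Ω → ℝ) (hS : Measurable[m] S)
    (h : ∀ A, MeasurableSet[m] A → ∀ x, μ (A ∩ Z ⁻¹' Ici x) = μ A * μ (Z ⁻¹' Ici x)) :
    IndepFun S Z μ := by
  rw [IndepFun_iff_Indep]
  refine indep_of_indep_of_le_left (m₁ := m) ?_ hS.comap_le
  refine IndepSets.indep (p1 := {s | MeasurableSet[m] s}) (p2 := preimage Z '' range Ici)
    hm hZ.comap_le (@MeasurableSpace.isPiSystem_measurableSet _ m)
    ?_ (@MeasurableSpace.generateFrom_measurableSet _ m).symm ?_ ?_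
  · rintro _ ⟨_, ⟨a, rfl⟩, rfl⟩ _ ⟨_, ⟨b, rfl⟩, rfl⟩ _
    exact ⟨_, ⟨a ⊔ b, rfl⟩, by rw [← preimage_inter, Ici_inter_Ici]⟩
  · rw [← MeasurableSpace.comap_generateFrom, ← borel_eq_generateFrom_Ici,
      BorelSpace.measurable_eq (α := ℝ)]
  · rw [IndepSets_iff]
    rintro A _ hA ⟨_, ⟨a, rfl⟩, rfl⟩
    exact h A hA a

theorem stmt7 {Ω : Type*} [m0 : MeasurableSpace Ω] (μ : Measure Ω) [IsProbabilityMeasure μ]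
    (K : ℕ) (hK : 1 ≤ K)
    (ℱ : ℕ → MeasurableSpace Ω) (hℱmono : Monotone ℱ) (hℱle : ∀ k, ℱ k ≤ m0)
    (hℱ0 : ℱ 0 = ⊥)
    (P : ℕ → Ω → ℝ)
    (hPmeas : ∀ k, 1 ≤ k → k ≤ K → Measurable[ℱ k] (P k))
    (hPval : ∀ k, 1 ≤ k → k ≤ K → ∀ ω, P k ω ∈ Set.Ioo (0 : ℝ) 1)
    (hcond : ∀ k, 1 ≤ k → k ≤ K → ∀ u ∈ Set.Icc (0 : ℝ) 1,
      μ[Set.indicator {ω | P k ω ≤ u} (fun _ => (1 : ℝ)) | ℱ (k - 1)] =ᵐ[μ] fun _ => u)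
    (w : ℕ → ℝ) (hw : ∀ k, 1 ≤ k → k ≤ K → 0 < w k)
    (hwsum : ∑ k ∈ Finset.Icc 1 K, (w k) ^ 2 = 1) :
    μ.map (fun ω => ∑ k ∈ Finset.Icc 1 K, w k * zval (P k ω)) = gaussianReal 0 1 ∧
    μ.map (fun ω => stdGaussSurv (∑ k ∈ Finset.Icc 1 K, w k * zval (P k ω))) = unif01 := by
  have main : ∀ n, n ≤ K →
      Measurable[ℱ n] (fun ω => ∑ k ∈ Finset.Icc 1 n, w k * zval (P k ω)) ∧
      μ.map (fun ω => ∑ k ∈ Finset.Icc 1 n, w k * zval (P k ω)) =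
        gaussianReal 0 (∑ k ∈ Finset.Icc 1 n, (w k) ^ 2).toNNReal := by
    intro n
    induction n with
    | zero =>
      intro _
      refine ⟨by simp, ?_⟩
      simp [gaussianReal_zero_var, Measure.map_const]
    | succ n ih =>
      intro hn
      obtain ⟨hS, hlaw⟩ := ih (by omega)
      have h1 : 1 ≤ n + 1 := by omega
      have hPm := hPmeas (n+1) h1 hn
      have hZ := meas_aux _ _ hPm (hPval (n+1) h1 hn)
      have hZ0 : Measurable (fun ω => zval (P (n+1) ω)) := hZ.mono (hℱle _) le_rfl
      have key := key_aux (ℱ n) μ (hℱle n) (P (n+1)) (hPm.mono (hℱle _) le_rfl)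
        (hPval (n+1) h1 hn) (hcond (n+1) h1 hn)
      have keyu : ∀ x, μ ((fun ω => zval (P (n+1) ω)) ⁻¹' Ici x)
          = ENNReal.ofReal (stdGaussSurv x) := fun x => by
        simpa using key univ (@MeasurableSet.univ _ (ℱ n)) x
      have hZlaw := law_aux μ _ hZ0 keyu
      have hind := indep_aux (ℱ n) μ (hℱle n) _ hZ0 _ hS
        (fun A hA x => by rw [key A hA x, keyu])
      have hind2 := hind.comp (measurable_id) (measurable_const_mul (w (n+1)))
      have hwl : μ.map ((fun y => w (n+1) * y) ∘ (fun ω => zval (P (n+1) ω)))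
          = gaussianReal 0 (w (n+1) ^ 2).toNNReal := by
        rw [← Measure.map_map (measurable_const_mul _) hZ0, hZlaw, gaussianReal_map_const_mul,
          mul_zero, mul_one]
        congr 1
        exact (Real.toNNReal_of_nonneg (sq_nonneg _)).symm
      have e := gaussianReal_add_gaussianReal_of_indepFun hind2 hlaw hwl
      have hsum : (fun ω => ∑ k ∈ Finset.Icc 1 (n+1), w k * zval (P k ω))
          = (fun ω => (∑ k ∈ Finset.Icc 1 n, w k * zval (P k ω)) + w (n+1) * zval (P (n+1) ω)) := by
        funext ω
        rw [Finset.sum_Icc_succ_top h1]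
      rw [hsum]
      refine ⟨?_, ?_⟩
      · exact Measurable.add (hS.mono (hℱmono (Nat.le_succ n)) le_rfl)
          (hZ.const_mul _)
      · rw [Finset.sum_Icc_succ_top h1, Real.toNNReal_add
          (Finset.sum_nonneg fun _ _ => sq_nonneg _) (sq_nonneg _)]
        rw [add_zero] at e
        exact e
  obtain ⟨hm, hl⟩ := main K le_rfl
  rw [hwsum, Real.toNNReal_one] at hl
  refine ⟨hl, ?_⟩
  have := Measure.map_map (μ := μ) surv_cont.measurable (hm.mono (hℱle K) le_rfl)
  rw [hl, gauss_map_surv] at this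
  exact this.symm
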